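/- The full SE-RRM produces identical solutions under symbol permutations: fix an initial state Z⁰ : Fin D → Fin I → Fin K → ℝ with Z⁰ d i k = z d for some z : Fin D → ℝ (constant along both position and symbol indices), the recurrence Zstate 0 X = Z⁰ and Zstate (t+1) X = SBlockL (E X + Zstate t X), and logits given by a fiber-wise linear map w : Fin D → ℝ via (logits Z) i k = ∑ d, w d * Z d i k. Fix T : ℕ and X : Fin I → Fin K, and suppose that for each position i there is k* i with (logits (Zstate T X)) i (k* i) > (logits (Zstate T X)) i k for all k ≠ k* i. Then for every symbol permutation ρ : Equiv.Perm (Fin K) and every i, ρ (k* i) is the unique strict maximizer over k of (logits (Zstate T (fun i' => ρ (X i')))) i; that is, the decoded solution of the relabeled task equals the relabeling of the decoded solution of the original task. -/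

import Mathlib

open Matrix BigOperators

noncomputable def softmax {n : ℕ} (x : Fin n → ℝ) : Fin n → ℝ :=
  fun i => Real.exp (x i) / ∑ j, Real.exp (x j)

noncomputable def Attn {D n : ℕ} (Wq Wk Wv : Matrix (Fin D) (Fin D) ℝ)
    (H : Matrix (Fin D) (Fin n) ℝ) : Matrix (Fin D) (Fin n) ℝ :=
  fun d j =>
    ∑ i, (softmax (fun i' =>
        dotProduct (Wq.mulVec (fun d => H d j)) (Wk.mulVec (fun d => H d i')))) i *
      (Wv.mulVec (fun d' => H d' i)) d

def PosT {D I K : ℕ} (σ : Equiv.Perm (Fin I)) (Z : Fin D → Fin I → Fin K → ℝ) :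
    Fin D → Fin I → Fin K → ℝ :=
  fun d i k => Z d (σ i) k

def SymT {D I K : ℕ} (ρ : Equiv.Perm (Fin K)) (Z : Fin D → Fin I → Fin K → ℝ) :
    Fin D → Fin I → Fin K → ℝ :=
  fun d i k => Z d i (ρ k)

noncomputable def TI {D I K : ℕ} (Wq Wk Wv : Matrix (Fin D) (Fin D) ℝ)
    (Z : Fin D → Fin I → Fin K → ℝ) : Fin D → Fin I → Fin K → ℝ :=
  fun d i k => (Attn Wq Wk Wv (fun d' i' => Z d' i' k)) d i

noncomputable def TK {D I K : ℕ} (Wq Wk Wv : Matrix (Fin D) (Fin D) ℝ)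
    (Z : Fin D → Fin I → Fin K → ℝ) : Fin D → Fin I → Fin K → ℝ :=
  fun d i k => (Attn Wq Wk Wv (fun d' k' => Z d' i k')) d k

def FiberT {D I K : ℕ} (g : (Fin D → ℝ) → (Fin D → ℝ))
    (Z : Fin D → Fin I → Fin K → ℝ) : Fin D → Fin I → Fin K → ℝ :=
  fun d i k => g (fun d' => Z d' i k) d

noncomputable def SLayer {D I K : ℕ} (Wq Wk Wv Wq' Wk' Wv' : Matrix (Fin D) (Fin D) ℝ)
    (norm m : (Fin D → ℝ) → (Fin D → ℝ))
    (Z : Fin D → Fin I → Fin K → ℝ) : Fin D → Fin I → Fin K → ℝ :=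
  let Z' := FiberT norm (Z + TI Wq Wk Wv Z)
  let Z'' := FiberT norm (Z' + TK Wq' Wk' Wv' Z')
  FiberT norm (Z'' + FiberT m Z'')

noncomputable def SBlock {D I K : ℕ} (Wq Wk Wv Wq' Wk' Wv' : Matrix (Fin D) (Fin D) ℝ)
    (norm m : (Fin D → ℝ) → (Fin D → ℝ)) (L : ℕ) :
    (Fin D → Fin I → Fin K → ℝ) → (Fin D → Fin I → Fin K → ℝ) :=
  (SLayer Wq Wk Wv Wq' Wk' Wv' norm m)^[L]

noncomputable def Emb {D I K : ℕ} (d₀ : Fin D → ℝ) (X : Fin I → Fin K) :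
    Fin D → Fin I → Fin K → ℝ :=
  fun a i k => if X i = k then d₀ a else 0

/-- Iterated SE-RRM recurrence: `Zstate 0 X = Z⁰`, `Zstate (t+1) X = SBlockL (E X + Zstate t X)`. -/
noncomputable def Zstate {D I K : ℕ} (Wq Wk Wv Wq' Wk' Wv' : Matrix (Fin D) (Fin D) ℝ)
    (norm m : (Fin D → ℝ) → (Fin D → ℝ)) (L : ℕ) (d₀ : Fin D → ℝ)
    (Z0 : Fin D → Fin I → Fin K → ℝ) :
    ℕ → (Fin I → Fin K) → (Fin D → Fin I → Fin K → ℝ)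
  | 0, _ => Z0
  | t + 1, X =>
      SBlock Wq Wk Wv Wq' Wk' Wv' norm m L
        (Emb d₀ X + Zstate Wq Wk Wv Wq' Wk' Wv' norm m L d₀ Z0 t X)

noncomputable def logits {D I K : ℕ} (w : Fin D → ℝ) (Z : Fin D → Fin I → Fin K → ℝ) :
    Fin I → Fin K → ℝ :=
  fun i k => ∑ d, w d * Z d i k

theorem softmax_comp_perm {n : ℕ} (ρ : Equiv.Perm (Fin n)) (x : Fin n → ℝ) (i : Fin n) :
    softmax (fun j => x (ρ j)) i = softmax x (ρ i) := by
  unfold softmax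
  rw [Equiv.sum_comp ρ (fun j => Real.exp (x j))]

theorem attn_comp_perm {D n : ℕ} (Wq Wk Wv : Matrix (Fin D) (Fin D) ℝ)
    (ρ : Equiv.Perm (Fin n)) (H : Matrix (Fin D) (Fin n) ℝ) (d : Fin D) (j : Fin n) :
    Attn Wq Wk Wv (fun d' i => H d' (ρ i)) d j = Attn Wq Wk Wv H d (ρ j) := by
  unfold Attn
  conv_rhs => rw [← Equiv.sum_comp ρ]
  refine Finset.sum_congr rfl fun i _ => ?_
  rw [← softmax_comp_perm ρ]

theorem symT_add {D I K : ℕ} (ρ : Equiv.Perm (Fin K)) (Z W : Fin D → Fin I → Fin K → ℝ) :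
    SymT ρ (Z + W) = SymT ρ Z + SymT ρ W := rfl

theorem symT_fiberT {D I K : ℕ} (ρ : Equiv.Perm (Fin K)) (g : (Fin D → ℝ) → (Fin D → ℝ))
    (Z : Fin D → Fin I → Fin K → ℝ) :
    SymT ρ (FiberT g Z) = FiberT g (SymT ρ Z) := rfl

theorem symT_TI {D I K : ℕ} (ρ : Equiv.Perm (Fin K)) (Wq Wk Wv : Matrix (Fin D) (Fin D) ℝ)
    (Z : Fin D → Fin I → Fin K → ℝ) :
    SymT ρ (TI Wq Wk Wv Z) = TI Wq Wk Wv (SymT ρ Z) := rfl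

theorem symT_TK {D I K : ℕ} (ρ : Equiv.Perm (Fin K)) (Wq Wk Wv : Matrix (Fin D) (Fin D) ℝ)
    (Z : Fin D → Fin I → Fin K → ℝ) :
    SymT ρ (TK Wq Wk Wv Z) = TK Wq Wk Wv (SymT ρ Z) := by
  funext d i k
  exact (attn_comp_perm Wq Wk Wv ρ (fun d' k' => Z d' i k') d k).symm

theorem symT_SLayer {D I K : ℕ} (ρ : Equiv.Perm (Fin K))
    (Wq Wk Wv Wq' Wk' Wv' : Matrix (Fin D) (Fin D) ℝ) (norm m : (Fin D → ℝ) → (Fin D → ℝ))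
    (Z : Fin D → Fin I → Fin K → ℝ) :
    SymT ρ (SLayer Wq Wk Wv Wq' Wk' Wv' norm m Z) =
      SLayer Wq Wk Wv Wq' Wk' Wv' norm m (SymT ρ Z) := by
  simp only [SLayer, symT_fiberT, symT_add, symT_TI, symT_TK]

theorem symT_SBlock {D I K : ℕ} (ρ : Equiv.Perm (Fin K))
    (Wq Wk Wv Wq' Wk' Wv' : Matrix (Fin D) (Fin D) ℝ) (norm m : (Fin D → ℝ) → (Fin D → ℝ))
    (L : ℕ) (Z : Fin D → Fin I → Fin K → ℝ) :
    SymT ρ (SBlock Wq Wk Wv Wq' Wk' Wv' norm m L Z) =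
      SBlock Wq Wk Wv Wq' Wk' Wv' norm m L (SymT ρ Z) :=
  Function.Semiconj.iterate_right (symT_SLayer ρ Wq Wk Wv Wq' Wk' Wv' norm m) L Z

theorem symT_emb {D I K : ℕ} (ρ : Equiv.Perm (Fin K)) (d₀ : Fin D → ℝ) (X : Fin I → Fin K) :
    SymT ρ (Emb d₀ (fun i => ρ (X i))) = Emb d₀ X := by
  funext a i k
  simp [SymT, Emb]

theorem symT_Zstate {D I K : ℕ} (ρ : Equiv.Perm (Fin K))
    (Wq Wk Wv Wq' Wk' Wv' : Matrix (Fin D) (Fin D) ℝ) (norm m : (Fin D → ℝ) → (Fin D → ℝ))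
    (L : ℕ) (d₀ : Fin D → ℝ) (Z0 : Fin D → Fin I → Fin K → ℝ) (hZ0 : SymT ρ Z0 = Z0)
    (t : ℕ) (X : Fin I → Fin K) :
    SymT ρ (Zstate Wq Wk Wv Wq' Wk' Wv' norm m L d₀ Z0 t (fun i => ρ (X i))) =
      Zstate Wq Wk Wv Wq' Wk' Wv' norm m L d₀ Z0 t X := by
  induction t with
  | zero => exact hZ0
  | succ t ih => simp only [Zstate, symT_SBlock, symT_add, symT_emb, ih]

theorem logits_symT {D I K : ℕ} (ρ : Equiv.Perm (Fin K)) (w : Fin D → ℝ)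
    (Z : Fin D → Fin I → Fin K → ℝ) (i : Fin I) (k : Fin K) :
    logits w (SymT ρ Z) i k = logits w Z i (ρ k) := rfl

theorem serrm_solution_equivariant_under_symbol_permutation {D I K : ℕ}
    (Wq Wk Wv Wq' Wk' Wv' : Matrix (Fin D) (Fin D) ℝ)
    (norm m : (Fin D → ℝ) → (Fin D → ℝ)) (L : ℕ) (d₀ : Fin D → ℝ)
    (Z0 : Fin D → Fin I → Fin K → ℝ) (z : Fin D → ℝ)
    (hZ0 : ∀ d i k, Z0 d i k = z d)
    (w : Fin D → ℝ) (T : ℕ) (X : Fin I → Fin K)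
    (kstar : Fin I → Fin K)
    (hmax : ∀ i, ∀ k, k ≠ kstar i →
      logits w (Zstate Wq Wk Wv Wq' Wk' Wv' norm m L d₀ Z0 T X) i (kstar i)
        > logits w (Zstate Wq Wk Wv Wq' Wk' Wv' norm m L d₀ Z0 T X) i k) :
    ∀ (ρ : Equiv.Perm (Fin K)) (i : Fin I), ∀ k, k ≠ ρ (kstar i) →
      logits w (Zstate Wq Wk Wv Wq' Wk' Wv' norm m L d₀ Z0 T (fun i' => ρ (X i'))) i (ρ (kstar i))
        > logits w (Zstate Wq Wk Wv Wq' Wk' Wv' norm m L d₀ Z0 T (fun i' => ρ (X i'))) i k := by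
  intro ρ i k hk
  have hsymm : SymT ρ Z0 = Z0 := by
    funext d i k
    simp only [SymT, hZ0]
  obtain ⟨k, rfl⟩ := ρ.surjective k
  rw [← logits_symT, ← logits_symT, symT_Zstate ρ _ _ _ _ _ _ _ _ _ _ _ hsymm]
  exact hmax i k fun h => hk (congrArg ρ h)
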